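/- Let d ≥ 2, D = {x ∈ ℝ^d : x_1 > 0}, and let B be the open ball of radius r > 0 centered at (r, 0, …, 0) (tangent to ∂D at the origin and contained in D). Then the D-Brownian meander almost surely stays in B for a positive amount of time: W̃^D_{0,1}(τ_B > 0) = 1, where τ_B = inf{t > 0 : X_t ∉ B}. -/

import Mathlib

open MeasureTheory ProbabilityTheory Filter Topology NNReal ENNReal

noncomputable section

abbrev E (d : ℕ) : Type := EuclideanSpace ℝ (Fin d)

abbrev PathSpace (d : ℕ) : Type := C(ℝ≥0, E d)

instance (d : ℕ) : MeasurableSpace (PathSpace d) := borel _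
instance (d : ℕ) : BorelSpace (PathSpace d) := ⟨rfl⟩

/-- `W` is the family of laws of standard `d`-dimensional Brownian motion:
`W x` is a probability measure on path space, starting a.s. at `x`, whose
increments have the finite-dimensional distributions of Brownian motion
(independent centered Gaussian coordinates with the right variances). -/
def IsWiener {d : ℕ} (W : E d → Measure (PathSpace d)) : Prop :=
  ∀ x : E d, IsProbabilityMeasure (W x) ∧ (W x) {w | w 0 = x} = 1 ∧
    ∀ (n : ℕ) (t : Fin (n + 1) → ℝ≥0), Monotone t →
      (W x).map (fun w (p : Fin n × Fin d) => w (t p.1.succ) p.2 - w (t p.1.castSucc) p.2)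
        = Measure.pi (fun p : Fin n × Fin d => gaussianReal 0 (t p.1.succ - t p.1.castSucc))

/-- First exit time from `U` : `τ_U = inf {t > 0 : X_t ∉ U}` (with value `∞` if the
path never leaves `U`). -/
def exitTime {d : ℕ} (U : Set (E d)) (w : PathSpace d) : ℝ≥0∞ :=
  sInf (((↑) : ℝ≥0 → ℝ≥0∞) '' {t : ℝ≥0 | 0 < t ∧ w t ∉ U})

/-- The law `W̃^U_{x,1}` of Brownian motion started at `x` conditioned to stay in `U`
for a unit of time. -/
def condLaw {d : ℕ} (W : E d → Measure (PathSpace d)) (U : Set (E d)) (x : E d) :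
    Measure (PathSpace d) :=
  ProbabilityTheory.cond (W x) {w | 1 < exitTime U w}


abbrev Path1 : Type := C(ℝ≥0, ℝ)

instance : MeasurableSpace Path1 := borel _
instance : BorelSpace Path1 := ⟨rfl⟩

/-- `W` is the family of laws of standard one-dimensional Brownian motion: `W x` is a
probability measure on path space, starting a.s. at `x`, with independent centered
Gaussian increments of the right variances. -/
def IsWiener1 (W : ℝ → Measure Path1) : Prop :=
  ∀ x : ℝ, IsProbabilityMeasure (W x) ∧ (W x) {w | w 0 = x} = 1 ∧
    ∀ (n : ℕ) (t : Fin (n + 1) → ℝ≥0), Monotone t →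
      (W x).map (fun w (i : Fin n) => w (t i.succ) - w (t i.castSucc))
        = Measure.pi (fun i : Fin n => gaussianReal 0 (t i.succ - t i.castSucc))

/-- `τ_+ = inf {t > 0 : X_t ≤ 0}`, the first exit time from `(0, ∞)`. -/
def exitTimePos (w : Path1) : ℝ≥0∞ :=
  sInf (((↑) : ℝ≥0 → ℝ≥0∞) '' {t : ℝ≥0 | 0 < t ∧ w t ≤ 0})

/-- `W̃^+_{x,1} = W_x(· | τ_+ > 1)`: Brownian motion started at `x` conditioned to stay
positive for a unit of time. -/
def condPos (W : ℝ → Measure Path1) (x : ℝ) : Measure Path1 :=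
  ProbabilityTheory.cond (W x) {w | 1 < exitTimePos w}


/-- `σ = sup {t < 1 : X_t = 0}`, the last zero of the path before time `1`. -/
def lastZero (w : Path1) : ℝ≥0 :=
  sSup {t : ℝ≥0 | t < 1 ∧ w t = 0}

/-- The meander transformation: `X̃_t = (1 - σ)^{-1/2} |X(σ + t(1 - σ))|`. Under `W_0`,
its law is the law of the one-dimensional Brownian meander. -/
def meanderMap (w : Path1) : Path1 :=
  ⟨fun t => (Real.sqrt ((1 - lastZero w : ℝ≥0) : ℝ))⁻¹ *
      |w (lastZero w + t * (1 - lastZero w))|, by fun_prop⟩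

/-- Assembling `d` one-dimensional paths into a path in `ℝ^d`. -/
def assemble {d : ℕ} (g : Fin d → Path1) : PathSpace d :=
  ⟨fun t => (EuclideanSpace.equiv (Fin d) ℝ).symm (fun i => g i t),
    (EuclideanSpace.equiv (Fin d) ℝ).symm.continuous.comp
      (continuous_pi fun i => (g i).continuous)⟩

/-- The law `W̃^D_{0,1}` of the `D`-Brownian meander, `D = {x : x₁ > 0}`: the process
`(BM, B₂, …, B_d)` where `BM` is a Brownian meander and `B₂, …, B_d` are one-dimensional
Brownian motions started at `0`, all mutually independent. -/
def meanderLawD (d : ℕ) (W1 : ℝ → Measure Path1) (hW1 : IsWiener1 W1) :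
    Measure (PathSpace d) :=
  haveI : IsProbabilityMeasure (W1 0) := (hW1 0).1
  (Measure.pi fun _ : Fin d => W1 0).map
    (fun g => assemble (fun i => if (i : ℕ) = 0 then meanderMap (g i) else g i))


section FirstHit

variable {Ω : Type*} {mΩ : MeasurableSpace Ω} {P : Measure Ω} {X : ℝ≥0 → Ω → ℝ}

/-- The event that the process `X`, observed along the times `t 0, t 1, …`, enters `U` for the
first time at index `k`. -/
def firstHit (X : ℝ≥0 → Ω → ℝ) (t : ℕ → ℝ≥0) (U : Set ℝ) (k : ℕ) : Set Ω :=
  {ω | X (t k) ω ∈ U ∧ ∀ j < k, X (t j) ω ∉ U}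

lemma measurableSet_firstHit (hm : ∀ t, Measurable (X t)) (t : ℕ → ℝ≥0) {U : Set ℝ}
    (hU : MeasurableSet U) (k : ℕ) : MeasurableSet (firstHit X t U k) := by
  refine (hm _ hU).inter ?_
  have : {ω | ∀ j < k, X (t j) ω ∉ U} = ⋂ j, ⋂ (_ : j < k), (X (t j) ⁻¹' U)ᶜ := by
    ext ω; simp
  change MeasurableSet {ω | ∀ j < k, X (t j) ω ∉ U}
  rw [this]
  exact MeasurableSet.iInter fun j => MeasurableSet.iInter fun _ => (hm _ hU).compl

lemma pairwise_disjoint_firstHit (t : ℕ → ℝ≥0) (U : Set ℝ) :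
    Pairwise (Function.onFun Disjoint (firstHit X t U)) := by
  intro i j hij
  refine Set.disjoint_left.2 fun ω hi hj => ?_
  rcases lt_or_gt_of_ne hij with h | h
  · exact hj.2 i h hi.1
  · exact hi.2 j h hj.1

lemma exists_firstHit {t : ℕ → ℝ≥0} {U : Set ℝ} {ω : Ω} {k : ℕ} (h : X (t k) ω ∈ U) :
    ∃ j ≤ k, ω ∈ firstHit X t U j := by
  classical
  have hex : ∃ k, X (t k) ω ∈ U := ⟨k, h⟩
  exact ⟨Nat.find hex, Nat.find_min' hex h, Nat.find_spec hex, fun j hj => Nat.find_min hex hj⟩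

lemma measure_firstHit_inter (hB : IsPreBrownianReal X P) {t : ℕ → ℝ≥0} (ht : Monotone t)
    {U : Set ℝ} (hU : MeasurableSet U) (k : ℕ) {F : Set (ℝ≥0 → ℝ)} (hF : MeasurableSet F) :
    P (firstHit X t U k ∩ {ω | (fun u => X (t k + u) ω - X (t k) ω) ∈ F}) =
      P (firstHit X t U k) * P {ω | (fun u => X (t k + u) ω - X (t k) ω) ∈ F} := by
  set A : Set (Set.Iic (t k) → ℝ) :=
    {f | f ⟨t k, Set.mem_Iic.2 le_rfl⟩ ∈ U ∧ ∀ j : Fin k, f ⟨t j, ht j.2.le⟩ ∉ U} with hA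
  have hAm : MeasurableSet A := by
    refine (measurable_pi_apply (⟨t k, Set.mem_Iic.2 le_rfl⟩ : Set.Iic (t k)) hU).inter ?_
    have : {f : Set.Iic (t k) → ℝ | ∀ j : Fin k, f ⟨t j, ht j.2.le⟩ ∉ U} =
      ⋂ j : Fin k, ((fun f : Set.Iic (t k) → ℝ => f ⟨t j, ht j.2.le⟩) ⁻¹' U)ᶜ := by
      ext f; simp
    change MeasurableSet {f : Set.Iic (t k) → ℝ | ∀ j : Fin k, f ⟨t j, ht j.2.le⟩ ∉ U}
    rw [this]
    exact MeasurableSet.iInter fun j =>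
      (measurable_pi_apply (⟨t j, ht j.2.le⟩ : Set.Iic (t k)) hU).compl
  have hpre : firstHit X t U k = (fun ω (s : Set.Iic (t k)) => X s ω) ⁻¹' A := by
    ext ω
    simp only [firstHit, hA, Set.mem_preimage, Set.mem_ofPred_eq]
    exact and_congr_right fun _ => ⟨fun h j => h j j.2, fun h j hj => h ⟨j, hj⟩⟩
  rw [hpre, Set.inter_comm, mul_comm]
  exact (hB.indepFun_shift (t k)).measure_inter_preimage_eq_mul F A hF hAm

lemma measure_biUnion_firstHit_inter (hB : IsPreBrownianReal X P) (hm : ∀ t, Measurable (X t))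
    {t : ℕ → ℝ≥0} (ht : Monotone t) {U : Set ℝ} (hU : MeasurableSet U) (K : Set ℕ)
    {F : ℕ → Set (ℝ≥0 → ℝ)} (hF : ∀ k, MeasurableSet (F k)) :
    P (⋃ k ∈ K, firstHit X t U k ∩ {ω | (fun u => X (t k + u) ω - X (t k) ω) ∈ F k}) =
      ∑' k : K, P (firstHit X t U k) *
        P {ω | (fun u => X (t k + u) ω - X (t k) ω) ∈ F k} := by
  rw [measure_biUnion K.to_countable]
  · exact tsum_congr fun k => measure_firstHit_inter hB ht hU k (hF k)
  · exact fun i _ j _ hij => (pairwise_disjoint_firstHit t U hij).mono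
      Set.inter_subset_left Set.inter_subset_left
  · intro k _
    refine (measurableSet_firstHit hm t hU k).inter ?_
    exact (measurable_pi_lambda _ fun u => (hm _).sub (hm _)) (hF k)

lemma measure_biUnion_firstHit (hm : ∀ t, Measurable (X t)) (t : ℕ → ℝ≥0) {U : Set ℝ}
    (hU : MeasurableSet U) (K : Set ℕ) :
    P (⋃ k ∈ K, firstHit X t U k) = ∑' k : K, P (firstHit X t U k) :=
  measure_biUnion K.to_countable (fun _ _ _ _ hij => pairwise_disjoint_firstHit t U hij)
    fun k _ => measurableSet_firstHit hm t hU k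

lemma measure_biUnion_firstHit_inter_le (hB : IsPreBrownianReal X P)
    (hm : ∀ t, Measurable (X t)) {t : ℕ → ℝ≥0} (ht : Monotone t) {U : Set ℝ}
    (hU : MeasurableSet U) (K : Set ℕ) {F : ℕ → Set (ℝ≥0 → ℝ)} (hF : ∀ k, MeasurableSet (F k))
    {p : ℝ≥0∞} (hp : ∀ k ∈ K, P {ω | (fun u => X (t k + u) ω - X (t k) ω) ∈ F k} ≤ p) :
    P (⋃ k ∈ K, firstHit X t U k ∩ {ω | (fun u => X (t k + u) ω - X (t k) ω) ∈ F k}) ≤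
      P (⋃ k ∈ K, firstHit X t U k) * p := by
  rw [measure_biUnion_firstHit_inter hB hm ht hU K hF, measure_biUnion_firstHit hm t hU,
    ← ENNReal.tsum_mul_right]
  exact ENNReal.tsum_le_tsum fun k => by gcongr; exact hp k k.2

lemma le_measure_biUnion_firstHit_inter (hB : IsPreBrownianReal X P)
    (hm : ∀ t, Measurable (X t)) {t : ℕ → ℝ≥0} (ht : Monotone t) {U : Set ℝ}
    (hU : MeasurableSet U) (K : Set ℕ) {F : ℕ → Set (ℝ≥0 → ℝ)} (hF : ∀ k, MeasurableSet (F k))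
    {p : ℝ≥0∞} (hp : ∀ k ∈ K, p ≤ P {ω | (fun u => X (t k + u) ω - X (t k) ω) ∈ F k}) :
    P (⋃ k ∈ K, firstHit X t U k) * p ≤
      P (⋃ k ∈ K, firstHit X t U k ∩ {ω | (fun u => X (t k + u) ω - X (t k) ω) ∈ F k}) := by
  rw [measure_biUnion_firstHit_inter hB hm ht hU K hF, measure_biUnion_firstHit hm t hU,
    ← ENNReal.tsum_mul_right]
  exact ENNReal.tsum_le_tsum fun k => by gcongr; exact hp k k.2

end FirstHit

section Symmetric

lemma gaussianReal_zero_preimage_neg (v : ℝ≥0) {s : Set ℝ} (hs : MeasurableSet s) :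
    gaussianReal 0 v (-s) = gaussianReal 0 v s := by
  have h := gaussianReal_map_neg (μ := 0) (v := v)
  rw [neg_zero] at h
  conv_rhs => rw [← h]
  rw [Measure.map_apply measurable_neg hs]
  rfl

lemma gaussianReal_Ioi_zero_le (v : ℝ≥0) : gaussianReal 0 v (Set.Ioi 0) ≤ 1 / 2 := by
  have h1 := gaussianReal_zero_preimage_neg v (measurableSet_Ioi (a := (0 : ℝ)))
  have h2 : gaussianReal 0 v (Set.Ioi 0 ∪ -Set.Ioi 0) ≤ 1 := prob_le_one
  rw [measure_union (by
    refine Set.disjoint_left.2 fun x hx hx' => ?_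
    simp only [Set.mem_neg, Set.mem_Ioi] at hx hx'
    linarith) measurableSet_Ioi.neg, h1, ← two_mul] at h2
  rwa [ENNReal.le_div_iff_mul_le (by simp) (by simp), mul_comm]

lemma half_le_gaussianReal_Ici_zero (v : ℝ≥0) : 1 / 2 ≤ gaussianReal 0 v (Set.Ici 0) := by
  have h1 := gaussianReal_zero_preimage_neg v (measurableSet_Ici (a := (0 : ℝ)))
  have h2 : (1 : ℝ≥0∞) ≤ gaussianReal 0 v (Set.Ici 0) + gaussianReal 0 v (-Set.Ici 0) := by
    refine le_trans (le_of_eq ?_) (measure_union_le _ _)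
    have : Set.Ici (0 : ℝ) ∪ -Set.Ici 0 = Set.univ := by
      ext x; simp
    rw [this, measure_univ]
  rw [h1, ← two_mul] at h2
  exact ENNReal.div_le_of_le_mul' h2

lemma gaussianReal_le_volume_div_sqrt {v : ℝ≥0} (hv : v ≠ 0) (s : Set ℝ) :
    gaussianReal 0 v s ≤ ENNReal.ofReal (√v)⁻¹ * volume s := by
  rw [gaussianReal_apply 0 hv, ← setLIntegral_const]
  refine lintegral_mono fun x => ENNReal.ofReal_le_ofReal ?_
  have hv' : (0 : ℝ) < v := by positivity
  rw [gaussianPDFReal_def]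
  have h1 : Real.exp (-(x - 0) ^ 2 / (2 * v)) ≤ 1 := by
    rw [Real.exp_le_one_iff]
    have : 0 ≤ (x - 0) ^ 2 / (2 * (v : ℝ)) := by positivity
    rw [neg_div]; linarith
  have h2 : (√(2 * Real.pi * v))⁻¹ ≤ (√(v : ℝ))⁻¹ := by
    refine inv_anti₀ (by positivity) (Real.sqrt_le_sqrt ?_)
    nlinarith [Real.pi_gt_three]
  calc _ ≤ (√(2 * Real.pi * v))⁻¹ * 1 := mul_le_mul_of_nonneg_left h1 (by positivity)
    _ ≤ _ := by rwa [mul_one]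

end Symmetric

/-- A set whose points eventually belong to sets of measure at most `C` has measure at
most `C`. -/
lemma measure_le_of_forall_eventually_mem {Ω : Type*} {mΩ : MeasurableSpace Ω} {P : Measure Ω}
    {S : Set Ω} {H : ℕ → Set Ω} {C : ℝ≥0∞} (hS : ∀ᵐ ω ∂P, ω ∈ S → ∀ᶠ m in atTop, ω ∈ H m)
    (hH : ∀ m, P (H m) ≤ C) : P S ≤ C := by
  have h1 : P S ≤ P (⋃ N, ⋂ m ≥ N, H m) := by
    refine measure_mono_ae ?_
    filter_upwards [hS] with ω hω h
    obtain ⟨N, hN⟩ := eventually_atTop.1 (hω h)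
    exact Set.mem_iUnion.2 ⟨N, Set.mem_iInter₂.2 hN⟩
  refine h1.trans ?_
  rw [Monotone.measure_iUnion]
  · exact iSup_le fun N => (measure_mono (Set.iInter₂_subset N le_rfl)).trans (hH N)
  · intro a b hab
    exact Set.biInter_subset_biInter_left fun m hm => le_trans hab hm

section Grid

/-- The grid of mesh `1 / (m + 1)`. -/
def grid (m k : ℕ) : ℝ≥0 := k / (m + 1)

lemma grid_mono (m : ℕ) : Monotone (grid m) := fun i j hij => by
  unfold grid; gcongr

lemma grid_zero (m : ℕ) : grid m 0 = 0 := by simp [grid]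

lemma grid_succ (m k : ℕ) : grid m (k + 1) = grid m k + 1 / (m + 1) := by
  simp [grid, add_div]

lemma grid_floor_le (m : ℕ) (u : ℝ≥0) : grid m ⌊u * (m + 1)⌋₊ ≤ u := by
  unfold grid
  rw [div_le_iff₀ (by positivity)]
  exact Nat.floor_le (by positivity)

lemma lt_grid_floor_add (m : ℕ) (u : ℝ≥0) : u < grid m ⌊u * (m + 1)⌋₊ + 1 / (m + 1) := by
  rw [← grid_succ, grid, lt_div_iff₀ (by positivity)]
  push_cast
  exact Nat.lt_floor_add_one _

lemma tendsto_grid_floor (u : ℝ≥0) :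
    Tendsto (fun m : ℕ => grid m ⌊u * (m + 1)⌋₊) atTop (𝓝 u) := by
  rw [← NNReal.tendsto_coe]
  have h1 : Tendsto (fun m : ℕ => (u : ℝ) - 1 / ((m : ℝ) + 1)) atTop (𝓝 (u - 0)) :=
    tendsto_const_nhds.sub tendsto_one_div_add_atTop_nhds_zero_nat
  rw [sub_zero] at h1
  refine tendsto_of_tendsto_of_tendsto_of_le_of_le h1 tendsto_const_nhds (fun m => ?_) fun m => ?_
  · have := NNReal.coe_lt_coe.2 (lt_grid_floor_add m u)
    push_cast at this
    simp only
    linarith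
  · exact NNReal.coe_le_coe.2 (grid_floor_le m u)

end Grid

section Maximal

variable {Ω : Type*} {mΩ : MeasurableSpace Ω} {P : Measure Ω} {X : ℝ≥0 → Ω → ℝ}

/-- Functions that stay below `y` up to time `s` at all times of all grids. -/
def belowOnGrids (s : ℝ≥0) (y : ℝ) : Set (ℝ≥0 → ℝ) :=
  {f | ∀ m k : ℕ, grid m k ≤ s → f (grid m k) < y}

lemma measurableSet_belowOnGrids (s : ℝ≥0) (y : ℝ) : MeasurableSet (belowOnGrids s y) := by
  have : belowOnGrids s y = ⋂ (m : ℕ), ⋂ (k : ℕ), ⋂ (_ : grid m k ≤ s),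
      (fun f : ℝ≥0 → ℝ => f (grid m k)) ⁻¹' Set.Iio y := by
    ext f; simp [belowOnGrids]
  rw [this]
  exact MeasurableSet.iInter fun m => MeasurableSet.iInter fun k => MeasurableSet.iInter fun _ =>
    measurable_pi_apply _ measurableSet_Iio

lemma measure_two_mul_lt_le (hB : IsPreBrownianReal X P) (hm : ∀ t, Measurable (X t))
    (hc : ∀ ω, Continuous (X · ω)) (s : ℝ≥0) {y : ℝ} (hy : 0 < y) :
    P {ω | 2 * y < X s ω} ≤ P {ω | (X · ω) ∈ belowOnGrids s y}ᶜ * (1 / 2) := by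
  refine measure_le_of_forall_eventually_mem
    (H := fun m => ⋃ k ∈ {k | grid m k ≤ s}, firstHit X (grid m) (Set.Ici y) k ∩
      {ω | (fun u => X (grid m k + u) ω - X (grid m k) ω) ∈
        {f : ℝ≥0 → ℝ | 0 < f (s - grid m k)}}) ?_ fun m => ?_
  · filter_upwards [hB.eval_zero_ae_eq_zero] with ω h0 hω
    have huc := (isCompact_Icc (a := (0 : ℝ≥0)) (b := s)).uniformContinuousOn_of_continuous
      (hc ω).continuousOn
    obtain ⟨δ, hδ, hclose⟩ := Metric.uniformContinuousOn_iff.1 huc y hy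
    filter_upwards [tendsto_one_div_add_atTop_nhds_zero_nat.eventually (gt_mem_nhds hδ)]
      with m hmδ
    set k := ⌊s * (m + 1)⌋₊ with hk
    have hks : grid m k ≤ s := grid_floor_le m s
    have hXk : X (grid m k) ω ∈ Set.Ici y := by
      have h1 : dist (grid m k) s < δ := by
        have h2 := NNReal.coe_lt_coe.2 (lt_grid_floor_add m s)
        push_cast at h2
        rw [dist_comm, NNReal.dist_eq, abs_of_nonneg (by simpa using hks)]
        linarith
      have h3 := hclose _ ⟨zero_le, hks⟩ _ ⟨zero_le, le_rfl⟩ h1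
      rw [Real.dist_eq, abs_lt] at h3
      change 2 * y < X s ω at hω
      exact Set.mem_Ici.2 (by linarith)
    obtain ⟨j, hjk, hj⟩ := exists_firstHit hXk
    have hjs : grid m j ≤ s := (grid_mono m hjk).trans hks
    have hlt : X (grid m j) ω < 2 * y := by
      rcases j with _ | i
      · rw [grid_zero, h0]; positivity
      · have hi := hj.2 i i.lt_succ_self
        rw [Set.mem_Ici, not_le] at hi
        have h1 : dist (grid m (i + 1)) (grid m i) < δ := by
          rw [NNReal.dist_eq, grid_succ]
          push_cast
          rw [add_sub_cancel_left, abs_of_nonneg (by positivity)]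
          exact hmδ
        have h3 := hclose _ ⟨zero_le, hjs⟩ _
          ⟨zero_le, (grid_mono m i.le_succ).trans hjs⟩ h1
        rw [Real.dist_eq, abs_lt] at h3
        linarith
    refine Set.mem_iUnion₂.2 ⟨j, hjs, hj, ?_⟩
    simp only [Set.mem_ofPred_eq, add_tsub_cancel_of_le hjs] at hω ⊢
    linarith
  · refine (measure_biUnion_firstHit_inter_le hB hm (grid_mono m) measurableSet_Ici _
      (p := 1 / 2) (fun k => ?_) fun k hk => ?_).trans ?_
    · exact measurable_pi_apply (s - grid m k) measurableSet_Ioi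
    · have h := ((hB.shift (grid m k)).hasLaw_eval (s - grid m k)).measure_eq
        (p := fun x => 0 < x) measurableSet_Ioi
      exact h.trans_le (gaussianReal_Ioi_zero_le _)
    · gcongr
      refine Set.iUnion₂_subset fun k hk ω hω h => ?_
      exact absurd (h m k hk) (not_lt.2 hω.1)

/-- Small ball estimate for the maximum of Brownian motion. -/
lemma measure_belowOnGrids_le (hB : IsPreBrownianReal X P) (hm : ∀ t, Measurable (X t))
    (hc : ∀ ω, Continuous (X · ω)) {s : ℝ≥0} (hs : s ≠ 0) {y : ℝ} (hy : 0 < y) :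
    P {ω | (X · ω) ∈ belowOnGrids s y} ≤ ENNReal.ofReal (4 * y / √s) := by
  have : IsProbabilityMeasure P := hB.isGaussianProcess.isProbabilityMeasure
  set F := {ω | (X · ω) ∈ belowOnGrids s y} with hF
  have hFm : MeasurableSet F := (measurable_pi_lambda _ hm) (measurableSet_belowOnGrids s y)
  have h1 := measure_two_mul_lt_le hB hm hc s hy
  have hlaw := hB.hasLaw_eval s
  rw [hlaw.measure_eq (p := fun x => 2 * y < x) measurableSet_Ioi] at h1
  set b := gaussianReal 0 s {x | 2 * y < x} with hb
  have hbtop : b ≠ ∞ := measure_ne_top _ _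
  have h2 : P F + 2 * b ≤ 1 := by
    calc P F + 2 * b ≤ P F + 2 * (P Fᶜ * (1 / 2)) := by gcongr
      _ = P F + P Fᶜ := by
        rw [mul_comm (P Fᶜ), ← mul_assoc, one_div,
          ENNReal.mul_inv_cancel (by simp) (by simp), one_mul]
      _ = 1 := by rw [measure_add_measure_compl hFm, measure_univ]
  have h3 : (1 : ℝ≥0∞) ≤ gaussianReal 0 s (Set.Icc (-(2 * y)) (2 * y)) + 2 * b := by
    have hneg := gaussianReal_zero_preimage_neg s (measurableSet_Ioi (a := 2 * y))
    calc (1 : ℝ≥0∞) = gaussianReal 0 s Set.univ := measure_univ.symm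
      _ ≤ gaussianReal 0 s (Set.Icc (-(2 * y)) (2 * y) ∪ (Set.Ioi (2 * y) ∪ -Set.Ioi (2 * y))) := by
        refine measure_mono fun x _ => ?_
        simp only [Set.mem_union, Set.mem_Icc, Set.mem_Ioi, Set.mem_neg]
        by_contra! h
        linarith [h.1 (by linarith)]
      _ ≤ _ := by
        refine (measure_union_le _ _).trans ?_
        gcongr
        refine (measure_union_le _ _).trans ?_
        rw [hneg, ← two_mul]
        rfl
  have h4 : P F ≤ gaussianReal 0 s (Set.Icc (-(2 * y)) (2 * y)) :=
    (ENNReal.add_le_add_iff_right (ENNReal.mul_ne_top (by simp) hbtop)).1 (h2.trans h3)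
  refine h4.trans ((gaussianReal_le_volume_div_sqrt hs _).trans (le_of_eq ?_))
  rw [Real.volume_Icc, ← ENNReal.ofReal_mul (by positivity)]
  congr 1
  ring

lemma measure_exists_lt_le (hB : IsPreBrownianReal X P) (hm : ∀ t, Measurable (X t))
    (hc : ∀ ω, Continuous (X · ω)) (s : ℝ≥0) (a : ℝ) :
    P {ω | ∃ u ≤ s, a < X u ω} ≤ 2 * P {ω | a < X s ω} := by
  refine measure_le_of_forall_eventually_mem
    (H := fun m => ⋃ k ∈ {k | grid m k ≤ s}, firstHit X (grid m) (Set.Ioi a) k) ?_ fun m => ?_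
  · refine ae_of_all _ fun ω ⟨u, hus, hu⟩ => ?_
    filter_upwards [((hc ω).tendsto u |>.comp (tendsto_grid_floor u)).eventually
      (lt_mem_nhds hu)] with m hm
    obtain ⟨j, hjk, hj⟩ := exists_firstHit (U := Set.Ioi a) hm
    exact Set.mem_iUnion₂.2 ⟨j, (grid_mono m hjk).trans ((grid_floor_le m u).trans hus), hj⟩
  · have h := le_measure_biUnion_firstHit_inter hB hm (grid_mono m) (measurableSet_Ioi (a := a))
      {k | grid m k ≤ s} (F := fun k => {f | 0 ≤ f (s - grid m k)}) (p := 1 / 2)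
      (fun k => measurable_pi_apply (s - grid m k) measurableSet_Ici) fun k hk => by
        have h := ((hB.shift (grid m k)).hasLaw_eval (s - grid m k)).measure_eq
          (p := fun x => 0 ≤ x) measurableSet_Ici
        exact (half_le_gaussianReal_Ici_zero _).trans_eq h.symm
    have h' := h.trans (measure_mono (t := {ω | a < X s ω}) (Set.iUnion₂_subset
      fun k (hk : grid m k ≤ s) ω hω => ?_))
    · rw [one_div, ← div_eq_mul_inv] at h'
      rw [mul_comm]
      exact (ENNReal.div_le_iff_le_mul (by simp) (by simp)).1 h'
    · obtain ⟨h1, h2⟩ := hω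
      have h1 := h1.1
      simp only [Set.mem_ofPred_eq, Set.mem_Ioi, add_tsub_cancel_of_le hk] at h1 h2 ⊢
      linarith

/-- Maximal inequality for Brownian motion. -/
lemma measure_exists_lt_abs_le (hB : IsPreBrownianReal X P) (hm : ∀ t, Measurable (X t))
    (hc : ∀ ω, Continuous (X · ω)) (s : ℝ≥0) {a : ℝ} (ha : 0 < a) :
    P {ω | ∃ u ≤ s, a < |X u ω|} ≤ ENNReal.ofReal (4 * (s / a ^ 2)) := by
  have : IsProbabilityMeasure P := hB.isGaussianProcess.isProbabilityMeasure
  have hcheb : P {ω | a ≤ |X s ω|} ≤ ENNReal.ofReal (s / a ^ 2) := by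
    have h := meas_ge_le_variance_div_sq (hB.hasLaw_eval s).hasGaussianLaw.memLp_two ha
    rw [hB.integral_eval, (hB.hasLaw_eval s).variance_eq, variance_id_gaussianReal] at h
    exact le_trans (measure_mono fun ω hω => by simpa using hω) h
  have h1 := measure_exists_lt_le hB hm hc s a
  have h2 := measure_exists_lt_le hB.neg (fun t => (hm t).neg) (fun ω => (hc ω).neg) s a
  calc P {ω | ∃ u ≤ s, a < |X u ω|}
      ≤ P ({ω | ∃ u ≤ s, a < X u ω} ∪ {ω | ∃ u ≤ s, a < (-X) u ω}) := by
        refine measure_mono fun ω ⟨u, hu, h⟩ => ?_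
        rcases lt_abs.1 h with h | h
        exacts [Or.inl ⟨u, hu, h⟩, Or.inr ⟨u, hu, h⟩]
    _ ≤ 2 * P {ω | a < X s ω} + 2 * P {ω | a < (-X) s ω} :=
        (measure_union_le _ _).trans (add_le_add h1 h2)
    _ ≤ 2 * P {ω | a ≤ |X s ω|} + 2 * P {ω | a ≤ |X s ω|} := by
        gcongr with ω ω
        · intro h; exact h.le.trans (le_abs_self _)
        · intro h; exact (le_of_lt h).trans (neg_le_abs _)
    _ = 4 * P {ω | a ≤ |X s ω|} := by rw [← add_mul]; norm_num
    _ ≤ 4 * ENNReal.ofReal (s / a ^ 2) := by gcongr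
    _ = _ := by rw [ENNReal.ofReal_mul (by norm_num)]; norm_num

end Maximal

section NoReturn

variable {Ω : Type*} {mΩ : MeasurableSpace Ω} {P : Measure Ω} {X : ℝ≥0 → Ω → ℝ}

lemma pos_of_continuousOn_of_ne_zero {f : ℝ≥0 → ℝ} {a b : ℝ≥0} (hab : a ≤ b)
    (hf : ContinuousOn f (Set.Icc a b)) (h0 : ∀ u ∈ Set.Icc a b, f u ≠ 0) (ha : 0 < f a) :
    0 < f b := by
  by_contra! hb
  obtain ⟨u, hu, hu0⟩ := intermediate_value_Icc' hab hf ⟨hb, ha.le⟩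
  exact h0 u hu hu0

/-- Brownian motion which comes close to `0` at some time after time `1` vanishes shortly
afterwards, unless it vanished already, with high probability. -/
lemma measure_near_zero_no_return_le (hB : IsPreBrownianReal X P) (hm : ∀ t, Measurable (X t))
    (hc : ∀ ω, ∀ t ≠ 0, ContinuousAt (X · ω) t) {s : ℝ≥0} (hs : s ≠ 0) {y : ℝ} (hy : 0 < y) :
    P {ω | ∃ t ≥ 1, |X t ω| ≤ y ∧ ∀ u, 1 ≤ u → u ≤ t + s → X u ω ≠ 0} ≤
      ENNReal.ofReal (16 * (y / √s)) := by
  have : IsProbabilityMeasure P := hB.isGaussianProcess.isProbabilityMeasure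
  set G : Set (ℝ≥0 → ℝ) := belowOnGrids s (2 * y) ∪ (fun f => -f) ⁻¹' belowOnGrids s (2 * y)
    with hG
  have hGm : MeasurableSet G := (measurableSet_belowOnGrids _ _).union
    (measurable_pi_lambda _ (fun u => (measurable_pi_apply u).neg)
      (measurableSet_belowOnGrids s (2 * y)))
  have hmono (m : ℕ) : Monotone fun k => 1 + grid m k := fun i j hij => by
    have := grid_mono m hij
    simp only
    gcongr
  refine measure_le_of_forall_eventually_mem
    (H := fun m => ⋃ k ∈ Set.univ, firstHit X (fun k => 1 + grid m k)
      (Set.Ioo (-(2 * y)) (2 * y)) k ∩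
      {ω | (fun u => X (1 + grid m k + u) ω - X (1 + grid m k) ω) ∈ G}) ?_ fun m => ?_
  · refine ae_of_all _ fun ω ⟨t, ht, hty, hne⟩ => ?_
    have ht' : 1 + (t - 1) = t := add_tsub_cancel_of_le ht
    have hlim : Tendsto (fun m : ℕ => X (1 + grid m ⌊(t - 1) * (m + 1)⌋₊) ω) atTop
        (𝓝 (X t ω)) := by
      refine (hc ω t (by positivity)).tendsto.comp ?_
      have := (tendsto_grid_floor (t - 1)).const_add 1
      rwa [ht'] at this
    have hmem : Set.Ioo (-(2 * y)) (2 * y) ∈ 𝓝 (X t ω) := by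
      rw [abs_le] at hty
      exact Ioo_mem_nhds (by linarith) (by linarith)
    filter_upwards [hlim hmem] with m hmk
    obtain ⟨j, hjk, hj⟩ := exists_firstHit (t := fun k => 1 + grid m k) (X := X)
      (U := Set.Ioo (-(2 * y)) (2 * y)) hmk
    refine Set.mem_iUnion₂.2 ⟨j, trivial, hj, ?_⟩
    have hjt : 1 + grid m j ≤ t := by
      calc 1 + grid m j ≤ 1 + grid m ⌊(t - 1) * (m + 1)⌋₊ := hmono m hjk
        _ ≤ 1 + (t - 1) := by gcongr; exact grid_floor_le _ _
        _ = t := ht'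
    have h1j : 1 ≤ 1 + grid m j := le_self_add
    obtain ⟨hl, hr⟩ : X (1 + grid m j) ω ∈ Set.Ioo (-(2 * y)) (2 * y) := hj.1
    have hne' : ∀ v ≤ s, ∀ u ∈ Set.Icc (1 + grid m j) (1 + grid m j + v), X u ω ≠ 0 :=
      fun v hv u hu => hne u (h1j.trans hu.1) (hu.2.trans (add_le_add hjt hv))
    have hco (v) : ContinuousOn (X · ω) (Set.Icc (1 + grid m j) (1 + grid m j + v)) :=
      fun u hu => (hc ω u (by have := h1j.trans hu.1; positivity)).continuousWithinAt
    rcases lt_or_gt_of_ne (hne' 0 zero_le (1 + grid m j) ⟨le_rfl, le_self_add⟩) with h | h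
    · left
      intro n k hk
      have := pos_of_continuousOn_of_ne_zero le_self_add (hco (grid n k)).neg
        (fun u hu => neg_ne_zero.2 (hne' _ hk u hu)) (neg_pos.2 h)
      change 0 < -X (1 + grid m j + grid n k) ω at this
      simp only
      linarith
    · right
      intro n k hk
      have := pos_of_continuousOn_of_ne_zero le_self_add (hco (grid n k)) (hne' _ hk) h
      simp only [Pi.neg_apply]
      linarith
  · refine (measure_biUnion_firstHit_inter_le hB hm (hmono m) measurableSet_Ioo Set.univ
      (F := fun _ => G) (p := ENNReal.ofReal (16 * (y / √s))) (fun _ => hGm)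
      fun k _ => ?_).trans (mul_le_of_le_one_left' prob_le_one)
    have hY := hB.shift (1 + grid m k)
    have hYm (u) : Measurable fun ω => X (1 + grid m k + u) ω - X (1 + grid m k) ω :=
      (hm _).sub (hm _)
    have hYc (ω) : Continuous fun u => X (1 + grid m k + u) ω - X (1 + grid m k) ω := by
      refine Continuous.sub (continuous_iff_continuousAt.2 fun u => ?_) continuous_const
      exact ContinuousAt.comp (f := fun u => 1 + grid m k + u)
        (hc ω _ (by positivity)) (by fun_prop)
    have h1 := measure_belowOnGrids_le hY hYm hYc hs (y := 2 * y) (by positivity)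
    have h2 := measure_belowOnGrids_le hY.neg (fun u => (hYm u).neg) (fun ω => (hYc ω).neg) hs
      (y := 2 * y) (by positivity)
    refine (measure_union_le _ _).trans ((add_le_add h1 h2).trans (le_of_eq ?_))
    rw [← ENNReal.ofReal_add (by positivity) (by positivity)]
    congr 1
    ring

lemma ae_exists_zero (hB : IsPreBrownianReal X P) (hm : ∀ t, Measurable (X t))
    (hc : ∀ ω, Continuous (X · ω)) {s : ℝ≥0} (hs : s ≠ 0) :
    ∀ᵐ ω ∂P, ∃ t, 0 < t ∧ t ≤ s ∧ X t ω = 0 := by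
  have key (n : ℕ) : P {ω | ¬ ∃ t, 0 < t ∧ t ≤ s ∧ X t ω = 0} ≤
      ENNReal.ofReal (8 / √s * (1 / ((n : ℝ) + 1))) := by
    have hy : 0 < 1 / ((n : ℝ) + 1) := by positivity
    have h1 := measure_belowOnGrids_le hB hm hc hs hy
    have h2 := measure_belowOnGrids_le hB.neg (fun u => (hm u).neg) (fun ω => (hc ω).neg) hs hy
    refine (measure_mono_ae ?_).trans ((measure_union_le _ _).trans
      ((add_le_add h1 h2).trans (le_of_eq ?_)))
    · filter_upwards [hB.eval_zero_ae_eq_zero] with ω h0 hω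
      replace hω : ∀ t, 0 < t → t ≤ s → X t ω ≠ 0 := fun t ht hts h => hω ⟨t, ht, hts, h⟩
      have hpos : 0 < s := pos_of_ne_zero hs
      rcases lt_or_gt_of_ne (hω s hpos le_rfl) with h | h
      · left
        intro m k hk
        rcases (zero_le (a := grid m k)).eq_or_lt with h' | h'
        · simp only [← h', h0, hy]
        · refine lt_of_not_ge fun hge => ?_
          have := pos_of_continuousOn_of_ne_zero hk (hc ω).continuousOn
            (fun u hu => hω u (h'.trans_le hu.1) hu.2) (hy.trans_le hge)
          exact lt_asymm h this
      · right
        intro m k hk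
        rcases (zero_le (a := grid m k)).eq_or_lt with h' | h'
        · simp only [← h', Pi.neg_apply, h0, neg_zero, hy]
        · refine lt_of_not_ge fun hge => ?_
          have := pos_of_continuousOn_of_ne_zero hk (hc ω).neg.continuousOn
            (fun u hu => neg_ne_zero.2 (hω u (h'.trans_le hu.1) hu.2)) (hy.trans_le hge)
          change 0 < -X s ω at this
          linarith
    · rw [← ENNReal.ofReal_add (by positivity) (by positivity)]
      congr 1
      ring
  have hlim : Tendsto (fun n : ℕ => ENNReal.ofReal (8 / √s * (1 / ((n : ℝ) + 1)))) atTop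
      (𝓝 0) := by
    have := ENNReal.tendsto_ofReal
      (tendsto_one_div_add_atTop_nhds_zero_nat (𝕜 := ℝ) |>.const_mul (8 / √(s : ℝ)))
    simpa using this
  exact le_antisymm (ge_of_tendsto' hlim key) zero_le

lemma ae_eventually_notMem_of_le_geometric {S : ℕ → Set Ω} {C ρ : ℝ} (h0 : 0 ≤ ρ) (h1 : ρ < 1)
    (h : ∀ n, P (S n) ≤ ENNReal.ofReal (C * ρ ^ n)) : ∀ᵐ ω ∂P, ∀ᶠ n in atTop, ω ∉ S n := by
  refine ae_eventually_notMem (ne_top_of_le_ne_top ?_ (ENNReal.tsum_le_tsum h))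
  exact ((summable_geometric_of_lt_one h0 h1).mul_left C).tsum_ofReal_ne_top

/-- A Brownian motion is eventually small near time `0`. -/
lemma ae_eventually_abs_le (hB : IsPreBrownianReal X P) (hm : ∀ t, Measurable (X t))
    (hc : ∀ ω, Continuous (X · ω)) :
    ∀ᵐ ω ∂P, ∀ᶠ n : ℕ in atTop, ∀ u ≤ ((1 / 2) ^ 16) ^ n, |X u ω| ≤ ((1 / 2) ^ 7) ^ n := by
  have h := ae_eventually_notMem_of_le_geometric (P := P) (C := 4) (ρ := 1 / 4)
    (S := fun n => {ω | ∃ u ≤ ((1 / 2) ^ 16 : ℝ≥0) ^ n, ((1 / 2) ^ 7) ^ n < |X u ω|})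
    (by norm_num) (by norm_num) fun n => by
      refine (measure_exists_lt_abs_le hB hm hc _ (by positivity)).trans (le_of_eq ?_)
      push_cast
      rw [← pow_mul ((1 / 2 : ℝ) ^ 7), mul_comm n, pow_mul ((1 / 2 : ℝ) ^ 7), ← div_pow]
      norm_num
  filter_upwards [h] with ω hω
  filter_upwards [hω] with n hn u hu
  exact not_lt.1 fun hlt => hn ⟨u, hu, hlt⟩

lemma ae_eventually_return (hB : IsPreBrownianReal X P) (hm : ∀ t, Measurable (X t))
    (hc : ∀ ω, ∀ t ≠ 0, ContinuousAt (X · ω) t) :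
    ∀ᵐ ω ∂P, ∀ᶠ n : ℕ in atTop, ∀ t ≥ 1, |X t ω| ≤ ((1 / 2) ^ 12) ^ n →
      ∃ u, 1 ≤ u ∧ u ≤ t + ((1 / 2) ^ 16) ^ n ∧ X u ω = 0 := by
  have h := ae_eventually_notMem_of_le_geometric (P := P) (C := 16) (ρ := 1 / 16)
    (S := fun n => {ω | ∃ t ≥ 1, |X t ω| ≤ ((1 / 2) ^ 12) ^ n ∧
      ∀ u, 1 ≤ u → u ≤ t + ((1 / 2) ^ 16 : ℝ≥0) ^ n → X u ω ≠ 0})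
    (by norm_num) (by norm_num) fun n => by
      refine (measure_near_zero_no_return_le hB hm hc (by positivity) (by positivity)).trans
        (le_of_eq ?_)
      have : √((((1 / 2) ^ 16 : ℝ≥0) ^ n : ℝ≥0) : ℝ) = ((1 / 2) ^ 8) ^ n := by
        rw [Real.sqrt_eq_iff_mul_self_eq (by positivity) (by positivity)]
        push_cast
        rw [← mul_pow]
        norm_num
      rw [this, ← div_pow]
      norm_num
  filter_upwards [h] with ω hω
  filter_upwards [hω] with n hn t ht hty
  by_contra! hcon
  exact hn ⟨t, ht, hty, hcon⟩

end NoReturn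

section Paths

lemma measurable_eval_path (t : ℝ≥0) : Measurable fun w : Path1 => w t :=
  (continuous_eval_const t).measurable

lemma measurable_increment_path (s t : ℝ≥0) : Measurable fun w : Path1 => w t - w s :=
  (measurable_eval_path t).sub (measurable_eval_path s)

variable {W1 : ℝ → Measure Path1}

lemma IsWiener1.map_sub (hW1 : IsWiener1 W1) {n : ℕ} {t : Fin (n + 1) → ℝ≥0} (ht : Monotone t)
    (i : Fin n) : (W1 0).map (fun w => w (t i.succ) - w (t i.castSucc)) =
      gaussianReal 0 (t i.succ - t i.castSucc) := by
  have h := congrArg (Measure.map (Function.eval i)) ((hW1 0).2.2 n t ht)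
  rw [Measure.map_map (measurable_pi_apply i) (measurable_pi_lambda _ fun j =>
    measurable_increment_path (t j.castSucc) (t j.succ)), (measurePreserving_eval _ i).map_eq] at h
  exact h

lemma IsWiener1.ae_eval_zero (hW1 : IsWiener1 W1) : ∀ᵐ w ∂W1 0, w 0 = 0 := by
  have := (hW1 0).1
  refine (mem_ae_iff_prob_eq_one ?_).2 (hW1 0).2.1
  exact measurable_eval_path 0 (measurableSet_singleton 0)

lemma IsWiener1.isPreBrownianReal (hW1 : IsWiener1 W1) :
    IsPreBrownianReal (fun t (w : Path1) => w t) (W1 0) := by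
  have := (hW1 0).1
  refine HasIndepIncrements.isPreBrownianReal_of_hasLaw (fun t => ⟨?_, ?_⟩) fun n t ht => ?_
  · exact (measurable_eval_path t).aemeasurable
  · have h := hW1.map_sub (n := 1) (t := ![0, t]) (by
      rw [Fin.monotone_iff_le_succ]; intro i; fin_cases i; simp) 0
    simp only [Fin.succ_zero_eq_one, Matrix.cons_val_one, Fin.castSucc_zero,
      Matrix.cons_val_zero, tsub_zero, Matrix.cons_val_fin_one] at h
    rw [← h]
    refine Measure.map_congr ?_
    filter_upwards [hW1.ae_eval_zero] with w hw
    rw [hw, sub_zero]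
  · rw [iIndepFun_iff_map_fun_eq_pi_map fun i : Fin n =>
      (measurable_increment_path (t i.castSucc) (t i.succ)).aemeasurable, (hW1 0).2.2 n t ht]
    congr 1
    ext1 i
    exact (hW1.map_sub ht i).symm

lemma IsWiener1.ae_eval_one_ne_zero (hW1 : IsWiener1 W1) : ∀ᵐ w ∂W1 0, w 1 ≠ 0 := by
  have h := (hW1.isPreBrownianReal.hasLaw_eval 1).measure_eq (p := fun x => x = 0)
    (measurableSet_singleton 0)
  have := nullSingletonClass_gaussianReal (μ := 0) (v := 1) one_ne_zero
  have h0 : gaussianReal 0 1 {x : ℝ | x = 0} = 0 := measure_singleton 0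
  rw [h0] at h
  rw [ae_iff]
  simpa using h

/-- The last zero before time `1` of a path which vanishes before time `1` but not at time `1`. -/
lemma lastZero_spec {w : Path1} (h1 : w 1 ≠ 0) {t : ℝ≥0} (ht1 : t ≤ 1) (ht : w t = 0) :
    t ≤ lastZero w ∧ lastZero w < 1 ∧ w (lastZero w) = 0 ∧
      ∀ v, lastZero w < v → v ≤ 1 → w v ≠ 0 := by
  set Z : Set ℝ≥0 := {t | t < 1 ∧ w t = 0} with hZ
  have hmem {v} (hv : v ≤ 1) (h : w v = 0) : v ∈ Z :=
    ⟨lt_of_le_of_ne hv (by rintro rfl; exact h1 h), h⟩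
  have hbdd : BddAbove Z := ⟨1, fun v hv => hv.1.le⟩
  have hne : Z.Nonempty := ⟨t, hmem ht1 ht⟩
  have hcl : lastZero w ∈ closure Z := csSup_mem_closure hne hbdd
  have hz : w (lastZero w) = 0 := by
    have : closure Z ⊆ w ⁻¹' {0} :=
      closure_minimal (fun v hv => hv.2) (isClosed_singleton.preimage w.continuous)
    exact this hcl
  have hle : lastZero w ≤ 1 := csSup_le hne fun v hv => hv.1.le
  refine ⟨le_csSup hbdd (hmem ht1 ht), (hmem hle hz).1, hz, fun v hv hv1 h => ?_⟩
  exact hv.not_ge (le_csSup hbdd (hmem hv1 h))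

/-- After its last zero before time `1`, Brownian motion leaves `0` sufficiently fast. -/
lemma IsWiener1.ae_eventually_lastZero (hW1 : IsWiener1 W1) :
    ∀ᵐ w ∂W1 0, lastZero w < 1 ∧ w (lastZero w) = 0 ∧ 0 < lastZero w ∧
      ∀ᶠ n : ℕ in atTop, ∀ v ≤ 1, lastZero w + ((1 / 2) ^ 16) ^ n < v →
        lastZero w * ((1 / 2) ^ 12) ^ n < |w v| := by
  have hB := hW1.isPreBrownianReal
  filter_upwards [hW1.ae_eval_one_ne_zero, ae_exists_zero hB measurable_eval_path
    (fun w => w.continuous) one_ne_zero, ae_eventually_return hB.inv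
    (fun t => (measurable_eval_path _).const_mul _) (fun w t ht =>
      NNReal.continuous_coe.continuousAt.mul (w.continuous.continuousAt.comp
        (f := fun u : ℝ≥0 => 1 / u) (continuousAt_const.div₀ continuousAt_id ht)))]
    with w h1 ⟨t, ht0, ht1, ht⟩ hret
  obtain ⟨htσ, hσ1, hσ, hne⟩ := lastZero_spec h1 ht1 ht
  have hσ0 : 0 < lastZero w := ht0.trans_le htσ
  refine ⟨hσ1, hσ, hσ0, ?_⟩
  filter_upwards [hret] with n hn v hv1 hv
  set s : ℝ≥0 := ((1 / 2) ^ 16) ^ n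
  have hσv : lastZero w < v := lt_of_le_of_lt le_self_add hv
  have hv0 : 0 < v := hσ0.trans hσv
  by_contra! hcon
  obtain ⟨u, hu1, hus, hu⟩ := hn (1 / v)
    (by rw [ge_iff_le, le_div_iff₀ hv0, one_mul]; exact hv1) (by
    rw [one_div_one_div, abs_mul, NNReal.abs_eq]
    push_cast
    rw [one_div_mul_eq_div, div_le_iff₀ (by exact_mod_cast hv0)]
    refine hcon.trans ?_
    rw [mul_comm]
    gcongr)
  have hu0 : 0 < u := lt_of_lt_of_le one_pos hu1
  rcases mul_eq_zero.1 hu with h | h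
  · simp [hu0.ne'] at h
  refine hne (1 / u) ?_ ?_ h
  · rw [lt_div_iff₀ hu0]
    calc lastZero w * u ≤ lastZero w * (1 / v + s) := by gcongr
      _ < 1 := ?_
    rw [← NNReal.coe_lt_coe] at hv ⊢
    have hv0' : (0 : ℝ) < v := hv0
    have hσ0' : (0 : ℝ) < lastZero w := hσ0
    have hv1' : (v : ℝ) ≤ 1 := hv1
    push_cast at hv ⊢
    rw [mul_add, mul_one_div, ← lt_sub_iff_add_lt, div_lt_iff₀ hv0']
    nlinarith [mul_le_mul_of_nonneg_left hv1' hσ0'.le, NNReal.coe_nonneg s,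
      mul_le_mul_of_nonneg_left hv1' (mul_nonneg hσ0'.le s.coe_nonneg),
      mul_le_mul_of_nonneg_left (NNReal.coe_le_coe.2 hσ1.le) s.coe_nonneg]
  · rw [div_le_iff₀ hu0, one_mul]; exact hu1

end Paths

section Ball

lemma exists_eventually_le_meanderMap {w : Path1} (hσ1 : lastZero w < 1) (hσ0 : 0 < lastZero w)
    (h : ∀ᶠ n : ℕ in atTop, ∀ v ≤ 1, lastZero w + ((1 / 2) ^ 16) ^ n < v →
        lastZero w * ((1 / 2) ^ 12) ^ n < |w v|) :
    ∃ c > 0, ∀ᶠ n : ℕ in atTop, ∀ t ≤ 1, ((1 / 2) ^ 16) ^ n < t →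
      c * ((1 / 2) ^ 12) ^ n ≤ meanderMap w t := by
  have hκ : 0 < 1 - lastZero w := tsub_pos_of_lt hσ1
  obtain ⟨k, hk⟩ := exists_pow_lt_of_lt_one hκ (y := (1 / 2 : ℝ≥0) ^ 16)
    (pow_lt_one₀ zero_le (NNReal.half_lt_self one_ne_zero) (by norm_num))
  refine ⟨lastZero w * ((1 / 2) ^ 12) ^ k, by positivity, ?_⟩
  filter_upwards [(tendsto_add_atTop_nat k).eventually h] with n hn t ht1 ht
  have hv := hn (lastZero w + t * (1 - lastZero w)) ?_ ?_
  · have hsqrt : 1 ≤ (√((1 - lastZero w : ℝ≥0) : ℝ))⁻¹ := by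
      refine (one_le_inv₀ (Real.sqrt_pos.2 hκ)).2 (Real.sqrt_le_one.2 ?_)
      exact_mod_cast (tsub_le_self : 1 - lastZero w ≤ 1)
    calc _ = lastZero w * (((1 / 2) ^ 12) ^ (n + k) : ℝ) := by rw [pow_add]; ring
      _ ≤ |w (lastZero w + t * (1 - lastZero w))| := hv.le
      _ ≤ meanderMap w t := le_mul_of_one_le_left (abs_nonneg _) hsqrt
  · calc lastZero w + t * (1 - lastZero w) ≤ lastZero w + 1 * (1 - lastZero w) := by gcongr
      _ = 1 := by rw [one_mul, add_tsub_cancel_of_le hσ1.le]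
  · rw [pow_add]
    gcongr

lemma meanderMap_apply_zero {w : Path1} (h : w (lastZero w) = 0) : meanderMap w 0 = 0 := by
  change _ * |w (lastZero w + 0 * (1 - lastZero w))| = 0
  simp [h]

/-- A path starting at `0` whose first coordinate dominates the squares of the other coordinates
near time `0` stays for a while in a ball tangent at `0` to the hyperplane `x₁ = 0`. -/
lemma exitTime_ball_pos {d : ℕ} {r : ℝ} (hr : 0 < r) {f : PathSpace (d + 2)} (h0 : f 0 0 = 0)
    {c : ℝ} (hc : 0 < c)
    (hlow : ∀ᶠ n : ℕ in atTop, ∀ t ≤ 1, ((1 / 2) ^ 16) ^ n < t → c * ((1 / 2) ^ 12) ^ n ≤ f t 0)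
    (hup : ∀ i : Fin (d + 1), ∀ᶠ n : ℕ in atTop, ∀ t ≤ ((1 / 2) ^ 16) ^ n,
      |f t i.succ| ≤ ((1 / 2) ^ 7) ^ n) :
    0 < exitTime (Metric.ball (r • EuclideanSpace.single (0 : Fin (d + 2)) (1 : ℝ)) r) f := by
  have hq1 : (1 / 2 : ℝ≥0) ^ 16 < 1 :=
    pow_lt_one₀ zero_le (NNReal.half_lt_self one_ne_zero) (by norm_num)
  have hsmall : ∀ᶠ n : ℕ in atTop,
      (d + 1) * (((1 / 2) ^ 7) ^ n) ^ 2 < r * (c * ((1 / 2) ^ 12) ^ (n + 1)) := by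
    have hlim := (tendsto_pow_atTop_nhds_zero_of_lt_one (r := (1 / 4 : ℝ)) (by norm_num)
      (by norm_num)).const_mul ((d + 1 : ℝ))
    rw [mul_zero] at hlim
    have hb : 0 < r * (c * (1 / 2) ^ 12) := by positivity
    filter_upwards [hlim.eventually (gt_mem_nhds hb)]
      with n hn
    have e1 : (((1 / 2 : ℝ) ^ 7) ^ n) ^ 2 = (1 / 4) ^ n * ((1 / 2) ^ 12) ^ n := by
      rw [← pow_mul, mul_comm n, pow_mul, ← mul_pow]
      norm_num
    calc _ = (d + 1) * (1 / 4) ^ n * ((1 / 2 : ℝ) ^ 12) ^ n := by rw [e1, mul_assoc]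
      _ < r * (c * (1 / 2) ^ 12) * ((1 / 2 : ℝ) ^ 12) ^ n := by gcongr
      _ = _ := by rw [pow_succ]; ring
  have hfirst : ∀ᶠ n : ℕ in atTop, ∀ t ≤ ((1 / 2 : ℝ≥0) ^ 16) ^ n, f t 0 < r := by
    have hcont : Continuous fun t => f t 0 := by fun_prop
    have hlim := (hcont.tendsto 0).eventually (gt_mem_nhds (h0.trans_lt hr))
    obtain ⟨δ, hδ, hδr⟩ := NNReal.nhds_zero_basis.eventually_iff.1 hlim
    filter_upwards [(tendsto_pow_atTop_nhds_zero_of_lt_one (r := (1 / 2 : ℝ≥0) ^ 16) zero_le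
      hq1).eventually (gt_mem_nhds hδ)] with n hn t ht
    exact hδr (lt_of_le_of_lt ht hn)
  obtain ⟨N, hN⟩ := eventually_atTop.1
    (((hlow.and (eventually_all.2 hup)).and hsmall).and hfirst)
  set δ : ℝ≥0 := ((1 / 2) ^ 16) ^ N with hδ
  have hin : ∀ t, 0 < t → t ≤ δ →
      f t ∈ Metric.ball (r • EuclideanSpace.single (0 : Fin (d + 2)) (1 : ℝ)) r := by
    intro t ht htδ
    have ht1 : t ≤ 1 := htδ.trans (pow_le_one₀ zero_le hq1.le)
    obtain ⟨n, hn1, hn2⟩ := exists_nat_pow_near_of_lt_one ht ht1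
      (pow_pos (by norm_num) 16 : 0 < (1 / 2 : ℝ≥0) ^ 16) hq1
    have hNn : N ≤ n := by
      have := (pow_lt_pow_iff_right_of_lt_one₀ (pow_pos (by norm_num) 16) hq1).1
        (hn1.trans_le htδ)
      omega
    obtain ⟨⟨⟨-, hu⟩, hs⟩, hf⟩ := hN n hNn
    have hl := (hN (n + 1) (by omega)).1.1.1 t ht1 hn1
    rw [Metric.mem_ball, EuclideanSpace.dist_eq, Real.sqrt_lt' hr, Fin.sum_univ_succ]
    have hsum : ∑ i : Fin (d + 1), dist (f t i.succ)
        ((r • EuclideanSpace.single (0 : Fin (d + 2)) (1 : ℝ) : E (d + 2)) i.succ) ^ 2 ≤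
        (d + 1) * (((1 / 2) ^ 7) ^ n) ^ 2 := by
      refine (Finset.sum_le_card_nsmul _ _ ((((1 / 2) ^ 7) ^ n) ^ 2) fun i _ => ?_).trans_eq ?_
      · have : (r • EuclideanSpace.single (0 : Fin (d + 2)) (1 : ℝ) : E (d + 2)) i.succ = 0 := by
          simp
        rw [this, Real.dist_eq, sub_zero]
        exact pow_le_pow_left₀ (abs_nonneg _) (hu i t hn2) 2
      · simp
    have hzero : dist (f t 0)
        ((r • EuclideanSpace.single (0 : Fin (d + 2)) (1 : ℝ) : E (d + 2)) 0) ^ 2 =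
        (f t 0 - r) ^ 2 := by
      simp [Real.dist_eq, sq_abs]
    rw [hzero]
    have hfr := hf t hn2
    have hcn : 0 < c * ((1 / 2) ^ 12) ^ (n + 1) := by positivity
    nlinarith [mul_lt_mul_of_pos_left hfr (hcn.trans_le hl), mul_le_mul_of_nonneg_left hl hr.le]
  have hδpos : 0 < (δ : ℝ≥0∞) := by rw [ENNReal.coe_pos]; positivity
  refine hδpos.trans_le (le_sInf ?_)
  rintro _ ⟨t, ⟨ht, htU⟩, rfl⟩
  exact ENNReal.coe_le_coe.2 (le_of_not_ge fun h => htU (hin t ht h))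

end Ball

section Measurability

lemma isClosed_setOf_exists_zero (a b : ℝ≥0) :
    IsClosed {w : Path1 | ∃ t ∈ Set.Icc a b, w t = 0} := by
  have h : {w : Path1 | ∃ t ∈ Set.Icc a b, w t = 0} =
      {w : Path1 | Set.MapsTo w (Set.Icc a b) {0}ᶜ}ᶜ := by
    ext w
    change (∃ t ∈ Set.Icc a b, w t = 0) ↔ ¬ ∀ t ∈ Set.Icc a b, ¬ w t = 0
    push Not
    rfl
  rw [h]
  exact (ContinuousMap.isOpen_setOfPred_mapsTo isCompact_Icc isOpen_compl_singleton).isClosed_compl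

lemma lt_lastZero_iff {w : Path1} {a : ℝ≥0} :
    a < lastZero w ↔ ∃ n : ℕ, ∃ t ∈ Set.Icc (a + 1 / (n + 1)) (1 - 1 / (n + 1)), w t = 0 := by
  have hbdd : BddAbove {t : ℝ≥0 | t < 1 ∧ w t = 0} := ⟨1, fun v hv => hv.1.le⟩
  constructor
  · intro h
    have hne : {t : ℝ≥0 | t < 1 ∧ w t = 0}.Nonempty := by
      by_contra hcon
      rw [Set.not_nonempty_iff_eq_empty] at hcon
      simp [lastZero, hcon] at h
    obtain ⟨t, ⟨ht1, ht⟩, hat⟩ := exists_lt_of_lt_csSup hne h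
    obtain ⟨n, hn⟩ := exists_nat_one_div_lt (lt_min (tsub_pos_of_lt hat) (tsub_pos_of_lt ht1))
    obtain ⟨h1, h2⟩ := lt_min_iff.1 hn
    refine ⟨n, t, ⟨?_, ?_⟩, ht⟩
    · rw [add_comm]; exact (lt_tsub_iff_right.1 h1).le
    · refine le_tsub_of_add_le_left ?_
      exact (lt_tsub_iff_right.1 h2).le
  · rintro ⟨n, t, ⟨h1, h2⟩, ht⟩
    have hn : (0 : ℝ≥0) < 1 / (n + 1) := by positivity
    have ht1 : t < 1 := h2.trans_lt (tsub_lt_self one_pos hn)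
    exact (lt_add_of_pos_right a hn).trans_le (h1.trans (le_csSup hbdd ⟨ht1, ht⟩))

lemma measurable_lastZero : Measurable lastZero := by
  refine measurable_of_Ioi fun a => ?_
  have : lastZero ⁻¹' Set.Ioi a = ⋃ n : ℕ,
      {w : Path1 | ∃ t ∈ Set.Icc (a + 1 / (n + 1)) (1 - 1 / (n + 1)), w t = 0} := by
    ext w
    simp only [Set.mem_iUnion]
    exact lt_lastZero_iff
  rw [this]
  exact MeasurableSet.iUnion fun n => (isClosed_setOf_exists_zero _ _).measurableSet

/-- The path `t ↦ |w (s + t (1 - s))|`. -/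
def rescaleAbs (s : ℝ≥0) (w : Path1) : Path1 :=
  ⟨fun t => |w (s + t * (1 - s))|, by fun_prop⟩

lemma continuous_rescaleAbs : Continuous fun p : ℝ≥0 × Path1 => rescaleAbs p.1 p.2 := by
  refine ContinuousMap.continuous_of_continuous_uncurry _ ?_
  change Continuous fun q : (ℝ≥0 × Path1) × ℝ≥0 => |q.1.2 (q.1.1 + q.2 * (1 - q.1.1))|
  fun_prop

lemma measurable_meanderMap : Measurable meanderMap := by
  have h1 : Measurable fun w : Path1 => rescaleAbs (lastZero w) w :=
    continuous_rescaleAbs.measurable.comp (measurable_lastZero.prodMk measurable_id)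
  have h2 : Measurable fun w : Path1 => (√((1 - lastZero w : ℝ≥0) : ℝ))⁻¹ := by
    have := measurable_lastZero
    fun_prop
  have h3 : Continuous fun p : ℝ × Path1 => p.1 • p.2 := continuous_smul
  exact h3.measurable.comp (h2.prodMk h1)

lemma measurable_assemble {d : ℕ} : Measurable (assemble (d := d)) := by
  refine Continuous.measurable (ContinuousMap.continuous_of_continuous_uncurry _ ?_)
  refine (EuclideanSpace.equiv (Fin d) ℝ).symm.continuous.comp (continuous_pi fun i => ?_)
  change Continuous fun q : (Fin d → Path1) × ℝ≥0 => q.1 i q.2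
  fun_prop

lemma measurable_assemble_meanderMap (d : ℕ) : Measurable fun g : Fin d → Path1 =>
    assemble (fun i => if (i : ℕ) = 0 then meanderMap (g i) else g i) := by
  refine measurable_assemble.comp (measurable_pi_lambda _ fun i => ?_)
  split_ifs
  · exact measurable_meanderMap.comp (measurable_pi_apply i)
  · exact measurable_pi_apply i

end Measurability

/-- (Lemma 4.1, after Burdzy): let `d ≥ 2`, `D = {x : x₁ > 0}` and `B` the open ball of
radius `r > 0` centered at `(r, 0, …, 0)`, tangent to `∂D` at the origin. The `D`-Brownian
meander almost surely stays in `B` for a positive amount of time: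
`W̃^D_{0,1}(τ_B > 0) = 1`. -/
theorem meander_ball_irregular (d : ℕ)
    (W1 : ℝ → Measure Path1) (hW1 : IsWiener1 W1) (r : ℝ) (hr : 0 < r) :
    meanderLawD (d + 2) W1 hW1
        {w | 0 < exitTime (Metric.ball (r • EuclideanSpace.single (0 : Fin (d + 2)) (1 : ℝ)) r) w}
      = 1 := by
  have := (hW1 0).1
  have hB := hW1.isPreBrownianReal
  set μ := Measure.pi fun _ : Fin (d + 2) => W1 0 with hμ
  have hmeas := measurable_assemble_meanderMap (d + 2)
  have hmeander := (measurePreserving_eval (fun _ : Fin (d + 2) => W1 0)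
    0).quasiMeasurePreserving.ae hW1.ae_eventually_lastZero
  have hbm (i : Fin (d + 2)) := (measurePreserving_eval (fun _ : Fin (d + 2) => W1 0)
    i).quasiMeasurePreserving.ae
      (ae_eventually_abs_le hB measurable_eval_path fun w => w.continuous)
  unfold meanderLawD
  refine le_antisymm ((measure_mono (Set.subset_univ _)).trans_eq ?_) ?_
  · rw [Measure.map_apply hmeas MeasurableSet.univ, Set.preimage_univ, measure_univ]
  · refine le_trans (le_of_eq ?_) (Measure.le_map_apply hmeas.aemeasurable _)
    rw [← measure_univ (μ := μ)]
    refine (measure_congr (ae_eq_univ.2 ?_)).symm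
    change ∀ᵐ g ∂μ, _
    filter_upwards [hmeander, ae_all_iff.2 hbm] with g ⟨hσ1, hσ, hσ0, hg⟩ hb
    obtain ⟨c, hc, hlow⟩ := exists_eventually_le_meanderMap hσ1 hσ0 hg
    exact exitTime_ball_pos hr (meanderMap_apply_zero hσ) hc hlow fun i => hb i.succ

end
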